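/- arXiv:2310.01611 — 2 statements merged into one kernel-verified Lean document; each statement's English description precedes it below -/
import Mathlib

section
/- There exists an absolute constant c₂ > 0 such that for every odd prime p, Σ over ordered pairs (a, b) ∈ (ZMod p)ˣ × (ZMod p)ˣ with a ≠ b of ( (1/(p−1)) · Σ_{x ∈ (ZMod p)ˣ} h_a(x) · h_b(x) )² ≤ c₂ · p · (ln p)². -/
/-- The parity sign `z ↦ (-1) ^ z.val`, modified to vanish at `0`. -/
noncomputable def puncturedParity (p : ℕ) (z : ZMod p) : ℂ :=
  if z = 0 then 0 else (-1) ^ z.val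

theorem ZMod.sum_val_eq_sum_range {M : Type*} [AddCommMonoid M] (n : ℕ) [NeZero n] (g : ℕ → M) :
    ∑ z : ZMod n, g z.val = ∑ i ∈ Finset.range n, g i := by
  refine Finset.sum_nbij' ZMod.val (fun i => (i : ZMod n)) ?_ ?_ ?_ ?_ ?_
  · exact fun z _ => Finset.mem_range.2 z.val_lt
  · exact fun _ _ => Finset.mem_univ _
  · exact fun z _ => ZMod.natCast_zmod_val z
  · exact fun i hi => ZMod.val_cast_of_lt (Finset.mem_range.1 hi)
  · exact fun _ _ => rfl

open ZMod in
theorem one_add_mul_dft_puncturedParity {p : ℕ} [NeZero p] (hp : Odd p) (k : ZMod p) :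
    (1 + stdAddChar (-k)) * 𝓕 (puncturedParity p) k = 1 - stdAddChar (-k) := by
  set w : ℂ := stdAddChar (-k) with hw
  have hwp : w ^ p = 1 := by
    rw [hw, ← AddChar.map_nsmul_eq_pow]
    simp
  have hterm (z : ZMod p) : stdAddChar (-(z * k)) • puncturedParity p z
      = (-w) ^ z.val - if z = 0 then 1 else 0 := by
    have : stdAddChar (-(z * k)) = w ^ z.val := by
      rw [hw, ← AddChar.map_nsmul_eq_pow]
      simp
    rw [this, puncturedParity]
    split_ifs with hz
    · simp [hz]
    · rw [smul_eq_mul, ← mul_pow, mul_neg_one, sub_zero]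
  have hsum : 𝓕 (puncturedParity p) k = ∑ i ∈ Finset.range p, (-w) ^ i - 1 := by
    rw [dft_apply, Finset.sum_congr rfl fun z _ => hterm z, Finset.sum_sub_distrib,
      sum_val_eq_sum_range p fun i => (-w) ^ i]
    simp
  have hgeom := mul_geom_sum (-w) p
  rw [hp.neg_pow, hwp] at hgeom
  rw [hsum]
  linear_combination -hgeom

open ZMod in
theorem two_mul_abs_div_le_norm_one_add_stdAddChar {p : ℕ} [NeZero p] (k : ZMod p) :
    2 * |(p : ℝ) - 2 * k.val| / p ≤ ‖1 + stdAddChar (-k)‖ := by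
  have hp : (0 : ℝ) < p := by exact_mod_cast NeZero.pos p
  set x : ℝ := Real.pi * ((p - 2 * k.val) / p) with hx
  have hk : (k.val : ℝ) ≤ p := by exact_mod_cast k.val_lt.le
  have hx' : |x / 2| ≤ Real.pi / 2 := by
    have : |((p : ℝ) - 2 * k.val) / p| ≤ 1 := by
      rw [abs_div, abs_of_pos hp, div_le_one hp, abs_le]
      constructor <;> linarith [Nat.cast_nonneg (α := ℝ) k.val]
    rw [hx, abs_div, abs_mul, abs_of_pos Real.pi_pos, abs_two]
    nlinarith [Real.pi_pos]
  have hchar : stdAddChar (-k) = -Complex.exp (Complex.I * x) := by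
    have hcast : -k = ((-(k.val : ℤ) : ℤ) : ZMod p) := by simp
    rw [hcast, stdAddChar_coe, ← mul_neg_one (Complex.exp _), ← Complex.exp_neg_pi_mul_I, ← Complex.exp_add]
    congr 1
    have : (p : ℂ) ≠ 0 := by exact_mod_cast NeZero.ne p
    rw [hx]
    push_cast
    field_simp
    ring
  rw [hchar, ← sub_eq_add_neg, norm_sub_rev, Complex.norm_exp_I_mul_ofReal_sub_one, norm_mul,
    Real.norm_eq_abs, Real.norm_eq_abs, abs_two]
  have h := Real.mul_abs_le_abs_sin hx'
  have hval : 2 / Real.pi * |x / 2| = |(p : ℝ) - 2 * k.val| / p := by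
    rw [hx, abs_div, abs_mul, abs_div, abs_of_pos Real.pi_pos, abs_of_pos hp, abs_two]
    field_simp
  rw [hval] at h
  rw [mul_div_assoc]
  linarith

open ZMod in
theorem norm_dft_puncturedParity_le {p : ℕ} [NeZero p] (hp : Odd p) (k : ZMod p) :
    ‖𝓕 (puncturedParity p) k‖ ≤ p * |(p : ℝ) - 2 * k.val|⁻¹ := by
  have hp0 : (0 : ℝ) < p := by exact_mod_cast NeZero.pos p
  have hne : (p : ℝ) - 2 * k.val ≠ 0 := by
    intro h
    have : p = 2 * k.val := by exact_mod_cast sub_eq_zero.1 h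
    obtain ⟨n, hn⟩ := hp
    omega
  have hpos : 0 < |(p : ℝ) - 2 * k.val| := abs_pos.2 hne
  have h := congrArg norm (one_add_mul_dft_puncturedParity hp k)
  rw [norm_mul] at h
  have hle : ‖(1 : ℂ) - stdAddChar (-k)‖ ≤ 2 := by
    refine (norm_sub_le _ _).trans ?_
    rw [norm_one, AddChar.norm_apply]
    norm_num
  have hlow := mul_le_mul_of_nonneg_right (two_mul_abs_div_le_norm_one_add_stdAddChar k)
    (norm_nonneg (𝓕 (puncturedParity p) k))
  rw [h] at hlow
  have h2 := hlow.trans hle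
  rw [← div_eq_mul_inv, le_div_iff₀ hpos]
  rw [div_mul_eq_mul_div, div_le_iff₀ hp0] at h2
  linarith

theorem sum_range_inv_abs_sub_le {p : ℕ} (hp : Odd p) :
    ∑ i ∈ Finset.range p, |(p : ℝ) - 2 * i|⁻¹ ≤ 2 * (1 + Real.log p) := by
  obtain ⟨n, rfl⟩ := hp
  have hH (m : ℕ) (hm : m ≤ 2 * n + 1) :
      ∑ i ∈ Finset.range m, ((i : ℝ) + 1)⁻¹ ≤ 1 + Real.log ((2 * n + 1 : ℕ) : ℝ) := by
    refine le_trans ?_ (harmonic_le_one_add_log (2 * n + 1))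
    rw [harmonic]
    push_cast
    refine Finset.sum_le_sum_of_subset_of_nonneg (Finset.range_mono hm) fun i _ _ => ?_
    positivity
  have hsplit : 2 * n + 1 = (n + 1) + n := by ring
  have h1 : ∑ i ∈ Finset.range (n + 1), |((2 * n + 1 : ℕ) : ℝ) - 2 * i|⁻¹
      ≤ ∑ i ∈ Finset.range (n + 1), ((i : ℝ) + 1)⁻¹ := by
    rw [← Finset.sum_range_reflect (fun i : ℕ => |((2 * n + 1 : ℕ) : ℝ) - 2 * i|⁻¹)]
    refine Finset.sum_le_sum fun i hi => ?_
    have hi' : i ≤ n := Nat.lt_succ_iff.1 (Finset.mem_range.1 hi)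
    have hc : ((n + 1 - 1 - i : ℕ) : ℝ) = n - i := by
      rw [Nat.add_sub_cancel, Nat.cast_sub hi']
    rw [hc]
    refine inv_anti₀ (by positivity) (le_trans ?_ (le_abs_self _))
    push_cast
    linarith [Nat.cast_nonneg (α := ℝ) i]
  have h2 : ∑ i ∈ Finset.range n, |((2 * n + 1 : ℕ) : ℝ) - 2 * (n + 1 + i : ℕ)|⁻¹
      ≤ ∑ i ∈ Finset.range n, ((i : ℝ) + 1)⁻¹ := by
    refine Finset.sum_le_sum fun i _ => ?_
    refine inv_anti₀ (by positivity) (le_trans ?_ (neg_le_abs _))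
    push_cast
    linarith [Nat.cast_nonneg (α := ℝ) i]
  have hsum : ∑ i ∈ Finset.range (2 * n + 1), |((2 * n + 1 : ℕ) : ℝ) - 2 * i|⁻¹
      = ∑ i ∈ Finset.range (n + 1), |((2 * n + 1 : ℕ) : ℝ) - 2 * i|⁻¹
        + ∑ i ∈ Finset.range n, |((2 * n + 1 : ℕ) : ℝ) - 2 * (n + 1 + i : ℕ)|⁻¹ := by
    rw [← Finset.sum_range_add (fun i : ℕ => |((2 * n + 1 : ℕ) : ℝ) - 2 * i|⁻¹), ← hsplit]
  rw [hsum]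
  linarith [hH (n + 1) (by omega), hH n (by omega)]

open ZMod in
theorem sum_norm_dft_puncturedParity_le {p : ℕ} [NeZero p] (hp : Odd p) :
    ∑ k, ‖𝓕 (puncturedParity p) k‖ ≤ p * (2 * (1 + Real.log p)) := by
  calc ∑ k, ‖𝓕 (puncturedParity p) k‖
      ≤ ∑ k : ZMod p, p * |(p : ℝ) - 2 * k.val|⁻¹ :=
        Finset.sum_le_sum fun k _ => norm_dft_puncturedParity_le hp k
    _ = p * ∑ i ∈ Finset.range p, |(p : ℝ) - 2 * i|⁻¹ := by
        rw [← Finset.mul_sum, ZMod.sum_val_eq_sum_range p fun i : ℕ => |(p : ℝ) - 2 * i|⁻¹]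
    _ ≤ _ := by gcongr; exact sum_range_inv_abs_sub_le hp

open ZMod in
theorem sum_mul_comp_mul_eq_sum_dft {N : ℕ} [NeZero N] (f : ZMod N → ℂ) (t : ZMod N) :
    ∑ x, f x * f (t * x) = (N : ℂ)⁻¹ * ∑ j, 𝓕 f j * 𝓕 f (-(t * j)) := by
  have hinv (y : ZMod N) : f y = (N : ℂ)⁻¹ * ∑ j, stdAddChar (j * y) * 𝓕 f j := by
    conv_lhs => rw [← LinearEquiv.symm_apply_apply dft f, invDFT_apply]
    simp only [smul_eq_mul]
  calc ∑ x, f x * f (t * x)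
      = ∑ x, f x * ((N : ℂ)⁻¹ * ∑ j, stdAddChar (j * (t * x)) * 𝓕 f j) :=
        Finset.sum_congr rfl fun x _ => by rw [← hinv]
    _ = (N : ℂ)⁻¹ * ∑ x, ∑ j, f x * (stdAddChar (j * (t * x)) * 𝓕 f j) := by
        simp only [Finset.mul_sum]
        refine Finset.sum_congr rfl fun x _ => Finset.sum_congr rfl fun j _ => ?_
        ring
    _ = _ := by
        rw [Finset.sum_comm]
        congr 1
        refine Finset.sum_congr rfl fun j _ => ?_
        rw [dft_apply f (-(t * j)), Finset.mul_sum]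
        refine Finset.sum_congr rfl fun x _ => ?_
        have : -(x * -(t * j)) = j * (t * x) := by ring
        rw [this, smul_eq_mul]
        ring

open ZMod in
theorem sum_units_norm_sum_mul_comp_mul_le {p : ℕ} [Fact p.Prime] {f : ZMod p → ℂ}
    (hf : 𝓕 f 0 = 0) :
    ∑ t : (ZMod p)ˣ, ‖∑ x, f x * f (t * x)‖ ≤ (p : ℝ)⁻¹ * (∑ k, ‖𝓕 f k‖) ^ 2 := by
  have hinner (j : ZMod p) : ∑ t : (ZMod p)ˣ, ‖𝓕 f j‖ * ‖𝓕 f (-(t * j))‖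
      ≤ ‖𝓕 f j‖ * ∑ k, ‖𝓕 f k‖ := by
    rw [← Finset.mul_sum]
    rcases eq_or_ne j 0 with rfl | hj
    · simp [hf]
    · gcongr
      have hinj : Function.Injective fun t : (ZMod p)ˣ => -((t : ZMod p) * j) := fun s t hst =>
        Units.ext (mul_right_cancel₀ hj (neg_injective hst))
      calc ∑ t : (ZMod p)ˣ, ‖𝓕 f (-(t * j))‖
          = ∑ k ∈ Finset.univ.map ⟨_, hinj⟩, ‖𝓕 f k‖ := by rw [Finset.sum_map]; rfl
        _ ≤ _ := Finset.sum_le_sum_of_subset_of_nonneg (Finset.subset_univ _)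
            fun _ _ _ => norm_nonneg _
  calc ∑ t : (ZMod p)ˣ, ‖∑ x, f x * f (t * x)‖
      ≤ ∑ t : (ZMod p)ˣ, (p : ℝ)⁻¹ * ∑ j, ‖𝓕 f j‖ * ‖𝓕 f (-(t * j))‖ := by
        refine Finset.sum_le_sum fun t _ => ?_
        rw [sum_mul_comp_mul_eq_sum_dft, norm_mul, norm_inv, Complex.norm_natCast]
        gcongr
        refine (norm_sum_le _ _).trans_eq ?_
        simp only [norm_mul]
    _ = (p : ℝ)⁻¹ * ∑ j, ∑ t : (ZMod p)ˣ, ‖𝓕 f j‖ * ‖𝓕 f (-(t * j))‖ := by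
        rw [← Finset.mul_sum, Finset.sum_comm]
    _ ≤ (p : ℝ)⁻¹ * ∑ j, ‖𝓕 f j‖ * ∑ k, ‖𝓕 f k‖ := by
        gcongr with j
        exact hinner j
    _ = _ := by rw [← Finset.sum_mul, sq]

/-- The unnormalised correlation of the parity sign with its dilate by `t`. -/
def parityCorrelation {p : ℕ} [NeZero p] (t : (ZMod p)ˣ) : ℝ :=
  ∑ x : (ZMod p)ˣ, (-1 : ℝ) ^ (x : ZMod p).val * (-1 : ℝ) ^ ((t * x : (ZMod p)ˣ) : ZMod p).val

theorem norm_sum_puncturedParity_mul {p : ℕ} [Fact p.Prime] (t : (ZMod p)ˣ) :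
    ‖∑ x, puncturedParity p x * puncturedParity p (t * x)‖ = |parityCorrelation t| := by
  rw [← Real.norm_eq_abs, ← Complex.norm_real]
  congr 1
  rw [parityCorrelation, Complex.ofReal_sum]
  symm
  refine Fintype.sum_of_injective (fun x : (ZMod p)ˣ => (x : ZMod p)) Units.val_injective _ _ ?_ ?_
  · intro x hx
    have : x = 0 := by
      by_contra h
      exact hx ⟨Units.mk0 x h, rfl⟩
    simp [this, puncturedParity]
  · intro x
    simp [puncturedParity]

theorem sum_abs_parityCorrelation_le {p : ℕ} [Fact p.Prime] (hp : Odd p) :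
    ∑ t : (ZMod p)ˣ, |parityCorrelation t| ≤ 4 * p * (1 + Real.log p) ^ 2 := by
  have hp0 : (0 : ℝ) < p := by exact_mod_cast NeZero.pos p
  have hzero : ZMod.dft (puncturedParity p) 0 = 0 := by
    have h := one_add_mul_dft_puncturedParity hp 0
    rw [neg_zero, AddChar.map_zero_eq_one, sub_self, mul_eq_zero] at h
    exact h.resolve_left (by norm_num)
  simp only [← norm_sum_puncturedParity_mul]
  calc _ ≤ (p : ℝ)⁻¹ * (∑ k, ‖ZMod.dft (puncturedParity p) k‖) ^ 2 :=
        sum_units_norm_sum_mul_comp_mul_le hzero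
    _ ≤ (p : ℝ)⁻¹ * (p * (2 * (1 + Real.log p))) ^ 2 := by
        gcongr
        exact sum_norm_dft_puncturedParity_le hp
    _ = _ := by field_simp; ring

theorem abs_parityCorrelation_le {p : ℕ} [Fact p.Prime] (t : (ZMod p)ˣ) :
    |parityCorrelation t| ≤ p - 1 := by
  refine (Finset.abs_sum_le_sum_abs _ _).trans ?_
  simp [abs_mul, ZMod.card_units_eq_totient, Nat.totient_prime (Fact.out : p.Prime),
    Nat.cast_sub (Fact.out : p.Prime).one_lt.le]

theorem sum_parity_eq_parityCorrelation {p : ℕ} [NeZero p] (a b : (ZMod p)ˣ) :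
    ∑ x : (ZMod p)ˣ, (-1 : ℝ) ^ (((a⁻¹ * x : (ZMod p)ˣ) : ZMod p)).val *
      (-1 : ℝ) ^ (((b⁻¹ * x : (ZMod p)ˣ) : ZMod p)).val = parityCorrelation (b⁻¹ * a) := by
  rw [parityCorrelation]
  refine Fintype.sum_equiv (Equiv.mulLeft a⁻¹) _ _ fun x => ?_
  simp only [Equiv.coe_mulLeft, mul_assoc, mul_inv_cancel_left]


/-- There is an absolute constant `c₂ > 0` such that for every odd prime `p`, the sum over
ordered pairs `a ≠ b` in `(ZMod p)ˣ` of the squared inner products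
`((1/(p-1)) · Σ_x h_a(x)·h_b(x))²` is at most `c₂ · p · (ln p)²`, where
`h_a(x) = (-1)^((a⁻¹·x).val)` is the parity bit of the discrete logarithm of `x` to base
`a` in `(ZMod p, +)`. -/
theorem sum_sq_inner_parity_bits_le :
    ∃ c₂ : ℝ, 0 < c₂ ∧
      ∀ (p : ℕ) [Fact (Nat.Prime p)], Odd p →
        ∑ q ∈ (Finset.univ : Finset ((ZMod p)ˣ × (ZMod p)ˣ)).filter
            (fun q => q.1 ≠ q.2),
          ((1 / ((p : ℝ) - 1)) *
              ∑ x : (ZMod p)ˣ,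
                (-1 : ℝ) ^ (((q.1⁻¹ * x : (ZMod p)ˣ) : ZMod p)).val *
                  (-1 : ℝ) ^ (((q.2⁻¹ * x : (ZMod p)ˣ) : ZMod p)).val) ^ 2 ≤
          c₂ * p * (Real.log p) ^ 2 := by
  refine ⟨16, by norm_num, fun p _ hp => ?_⟩
  have hprime : p.Prime := Fact.out
  have hp3 : 3 ≤ p := by
    obtain ⟨n, hn⟩ := hp
    have := hprime.two_le
    omega
  have hp3' : (3 : ℝ) ≤ p := by exact_mod_cast hp3
  have hpos : (0 : ℝ) < p - 1 := by linarith
  have hlog : 1 ≤ Real.log p := by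
    rw [Real.le_log_iff_exp_le (by linarith)]
    linarith [Real.exp_one_lt_d9]
  have hsq (t : (ZMod p)ˣ) : ((1 / ((p : ℝ) - 1)) * parityCorrelation t) ^ 2
      ≤ (1 / ((p : ℝ) - 1)) * |parityCorrelation t| := by
    have h1 : (1 / ((p : ℝ) - 1)) * |parityCorrelation t| ≤ 1 := by
      rw [one_div_mul_eq_div, div_le_one hpos]
      exact abs_parityCorrelation_le t
    have h0 : 0 ≤ (1 / ((p : ℝ) - 1)) * |parityCorrelation t| := by positivity
    rw [← sq_abs, abs_mul, abs_of_pos (one_div_pos.2 hpos)]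
    nlinarith
  simp only [sum_parity_eq_parityCorrelation]
  calc _ ≤ ∑ q : (ZMod p)ˣ × (ZMod p)ˣ,
          ((1 / ((p : ℝ) - 1)) * parityCorrelation (q.2⁻¹ * q.1)) ^ 2 :=
        Finset.sum_le_sum_of_subset_of_nonneg (Finset.subset_univ _) fun _ _ _ => sq_nonneg _
    _ ≤ ∑ q : (ZMod p)ˣ × (ZMod p)ˣ,
          (1 / ((p : ℝ) - 1)) * |parityCorrelation (q.2⁻¹ * q.1)| :=
        Finset.sum_le_sum fun q _ => hsq _
    _ = ∑ _b : (ZMod p)ˣ, ∑ t : (ZMod p)ˣ, (1 / ((p : ℝ) - 1)) * |parityCorrelation t| := by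
        rw [Fintype.sum_prod_type_right]
        exact Finset.sum_congr rfl fun b _ => Equiv.sum_comp (Equiv.mulLeft b⁻¹)
          fun t => (1 / ((p : ℝ) - 1)) * |parityCorrelation t|
    _ = ∑ t : (ZMod p)ˣ, |parityCorrelation t| := by
        rw [Finset.sum_const, ← Finset.mul_sum, Finset.card_univ, ZMod.card_units_eq_totient,
          Nat.totient_prime hprime, nsmul_eq_mul, Nat.cast_sub hprime.one_lt.le, Nat.cast_one]
        field_simp
    _ ≤ 4 * p * (1 + Real.log p) ^ 2 := sum_abs_parityCorrelation_le hp
    _ ≤ 4 * p * (2 * Real.log p) ^ 2 := by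
        gcongr
        linarith
    _ = 16 * p * Real.log p ^ 2 := by ring
end

section
/- There exists an absolute constant c₂ > 0 with the following property. Let G be a finite cyclic group (written multiplicatively) of prime order p > 2, and let L : G → G → ℕ be any function such that for all non-identity elements a, x ∈ G one has 1 ≤ L(a, x) ≤ p−1 and a^{L(a,x)} = x (so L(a, x) is the discrete logarithm of x to base a). Then Σ over ordered pairs (a, b) of non-identity elements of G with a ≠ b of ( (1/(p−1)) · Σ_{x ∈ G, x ≠ 1} (−1)^{L(a,x) + L(b,x)} )² ≤ c₂ · p · (ln p)². -/
section

open Finset ZMod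
open scoped ZMod ComplexConjugate

/-- Parseval's identity for the discrete Fourier transform on `ZMod N`. -/
theorem ZMod.sum_norm_sq_dft {N : ℕ} [NeZero N] (Φ : ZMod N → ℂ) :
    ∑ k, ‖𝓕 Φ k‖ ^ 2 = N * ∑ j, ‖Φ j‖ ^ 2 := by
  have inversion (j : ZMod N) : ∑ k, stdAddChar (j * k) * 𝓕 Φ k = N * Φ j := by
    have h := congr_fun (dft_dft Φ) (-j)
    rw [dft_apply] at h
    simpa [mul_comm] using h
  apply Complex.ofReal_injective
  push_cast
  simp_rw [← Complex.conj_mul']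
  calc ∑ k, conj (𝓕 Φ k) * 𝓕 Φ k
      = ∑ k, ∑ j, conj (Φ j) * (stdAddChar (j * k) * 𝓕 Φ k) := by
        refine sum_congr rfl fun k _ => ?_
        conv_lhs => enter [1]; rw [dft_apply]
        rw [map_sum, sum_mul]
        refine sum_congr rfl fun j _ => ?_
        rw [smul_eq_mul, map_mul, ← AddChar.map_neg_eq_conj, neg_neg]
        ring
    _ = N * ∑ j, conj (Φ j) * Φ j := by
        rw [sum_comm, mul_sum]
        refine sum_congr rfl fun j _ => ?_
        rw [← mul_sum, inversion]
        ring

/-- The kernel operator `Φ ↦ (w ↦ ∑ y, Φ y * g (y * w))` on `ZMod p` is bounded in `ℓ²` by the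
`ℓ¹` norm of the Fourier transform of `g`, provided that `g` has mean zero. -/
theorem ZMod.sum_norm_sq_sum_mul_comp_mul_le {p : ℕ} [Fact p.Prime] (g Φ : ZMod p → ℂ)
    (hg : 𝓕 g 0 = 0) :
    p * ∑ w, ‖∑ y, Φ y * g (y * w)‖ ^ 2 ≤ (∑ k, ‖𝓕 g k‖) ^ 2 * ∑ y, ‖Φ y‖ ^ 2 := by
  have hp : (0 : ℝ) < p := mod_cast (Fact.out : p.Prime).pos
  have expand (w : ZMod p) :
      (p : ℂ) * ∑ y, Φ y * g (y * w) = ∑ k, 𝓕 g k * 𝓕 Φ (-(k * w)) := by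
    have inversion (t : ZMod p) : (p : ℂ) * g t = ∑ k, stdAddChar (k * t) * 𝓕 g k := by
      have h := congr_fun (dft_dft g) (-t)
      rw [dft_apply] at h
      simpa using h.symm
    calc (p : ℂ) * ∑ y, Φ y * g (y * w)
        = ∑ y, ∑ k, Φ y * (stdAddChar (k * (y * w)) * 𝓕 g k) := by
          rw [mul_sum]
          refine sum_congr rfl fun y _ => ?_
          rw [← mul_sum, ← inversion]
          ring
      _ = ∑ k, 𝓕 g k * 𝓕 Φ (-(k * w)) := by
          rw [sum_comm]
          refine sum_congr rfl fun k _ => ?_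
          rw [dft_apply Φ, mul_sum]
          refine sum_congr rfl fun y _ => ?_
          rw [smul_eq_mul, mul_neg, neg_neg, show y * (k * w) = k * (y * w) by ring]
          ring
  have cauchy (w : ZMod p) : (p : ℝ) ^ 2 * ‖∑ y, Φ y * g (y * w)‖ ^ 2 ≤
      (∑ k, ‖𝓕 g k‖) * ∑ k, ‖𝓕 g k‖ * ‖𝓕 Φ (-(k * w))‖ ^ 2 := by
    have h : (p : ℝ) * ‖∑ y, Φ y * g (y * w)‖ ≤ ∑ k, ‖𝓕 g k‖ * ‖𝓕 Φ (-(k * w))‖ := by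
      have := norm_sum_le univ fun k => 𝓕 g k * 𝓕 Φ (-(k * w))
      rw [← expand w] at this
      simpa using this
    rw [← mul_pow]
    refine (pow_le_pow_left₀ (by positivity) h 2).trans ?_
    refine sum_sq_le_sum_mul_sum_of_sq_le_mul _ (fun k _ => norm_nonneg _)
      (fun k _ => by positivity) fun k _ => le_of_eq (by ring)
  have dilate (k : ZMod p) : ‖𝓕 g k‖ * ∑ w, ‖𝓕 Φ (-(k * w))‖ ^ 2 =
      ‖𝓕 g k‖ * (p * ∑ y, ‖Φ y‖ ^ 2) := by
    by_cases hk : k = 0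
    · simp [hk, hg]
    · rw [← sum_norm_sq_dft]
      congr 1
      exact Equiv.sum_comp ((Equiv.mulLeft₀ k hk).trans (Equiv.neg _)) fun w => ‖𝓕 Φ w‖ ^ 2
  refine le_of_mul_le_mul_left ?_ hp
  calc (p : ℝ) * (p * ∑ w, ‖∑ y, Φ y * g (y * w)‖ ^ 2)
      = ∑ w, (p : ℝ) ^ 2 * ‖∑ y, Φ y * g (y * w)‖ ^ 2 := by rw [← mul_sum]; ring
    _ ≤ ∑ w, (∑ k, ‖𝓕 g k‖) * ∑ k, ‖𝓕 g k‖ * ‖𝓕 Φ (-(k * w))‖ ^ 2 :=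
        sum_le_sum fun w _ => cauchy w
    _ = (∑ k, ‖𝓕 g k‖) * ∑ k, ‖𝓕 g k‖ * ∑ w, ‖𝓕 Φ (-(k * w))‖ ^ 2 := by
        rw [← mul_sum, sum_comm]
        simp_rw [mul_sum]
    _ = p * ((∑ k, ‖𝓕 g k‖) ^ 2 * ∑ y, ‖Φ y‖ ^ 2) := by
        simp_rw [dilate]
        rw [← sum_mul]
        ring

/-- The parity sign of a nonzero residue, extended by `0` at `0`. -/
def paritySign {p : ℕ} (t : ZMod p) : ℝ := if t = 0 then 0 else (-1) ^ t.val

theorem abs_paritySign_le_one {p : ℕ} (t : ZMod p) : |paritySign t| ≤ 1 := by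
  unfold paritySign
  split_ifs <;> simp

theorem ZMod.sum_eq_sum_range {M : Type*} [AddCommMonoid M] {N : ℕ} [NeZero N] (f : ZMod N → M) :
    ∑ t, f t = ∑ i ∈ range N, f i := by
  refine sum_bij' (fun t _ => t.val) (fun i _ => (i : ZMod N)) ?_ ?_ ?_ ?_ ?_
  · exact fun t _ => mem_range.2 t.val_lt
  · simp
  · simp
  · exact fun i hi => val_cast_of_lt (mem_range.1 hi)
  · simp

theorem ZMod.two_mul_abs_le_mul_norm_one_add_stdAddChar {N : ℕ} [NeZero N] (k : ℕ) (hk : k < N) :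
    2 * |(N : ℝ) - 2 * k| ≤ N * ‖1 + stdAddChar (-(k : ZMod N))‖ := by
  have hN : (0 : ℝ) < N := mod_cast Nat.pos_of_neZero N
  have hkN : (k : ℝ) < N := mod_cast hk
  have hk0 : (0 : ℝ) ≤ k := k.cast_nonneg
  set x : ℝ := Real.pi * (N - 2 * k) / N with hx
  have key : ‖1 + stdAddChar (-(k : ZMod N))‖ = 2 * |Real.sin (x / 2)| := by
    have h : stdAddChar (-(k : ZMod N)) = -Complex.exp (Complex.I * x) := by
      have h1 := stdAddChar_coe (N := N) (-(k : ℤ))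
      push_cast at h1
      rw [h1, ← Complex.exp_sub_pi_mul_I, hx]
      have hN' : (N : ℂ) ≠ 0 := mod_cast hN.ne'
      congr 1
      push_cast
      field_simp
      ring
    rw [h, ← sub_eq_add_neg, norm_sub_rev, Complex.norm_exp_I_mul_ofReal_sub_one]
    simp
  have hle : |(N : ℝ) - 2 * k| ≤ N := abs_le.2 ⟨by linarith, by linarith⟩
  have hx2 : |x / 2| = Real.pi / 2 * (|(N : ℝ) - 2 * k| / N) := by
    rw [hx, abs_div, abs_div, abs_mul, abs_of_pos Real.pi_pos, abs_of_pos hN, abs_two]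
    ring
  have hsin := Real.mul_abs_le_abs_sin (x := x / 2) (by
    rw [hx2]
    exact mul_le_of_le_one_right (by positivity) ((div_le_one hN).2 hle))
  rw [hx2] at hsin
  rw [key]
  have : 2 / Real.pi * (Real.pi / 2 * (|(N : ℝ) - 2 * k| / N)) = |(N : ℝ) - 2 * k| / N := by
    field_simp
  rw [this, div_le_iff₀ hN] at hsin
  linarith

theorem dft_paritySign_mul {p : ℕ} [NeZero p] (hp : Odd p) (k : ZMod p) :
    𝓕 (fun t : ZMod p => (paritySign t : ℂ)) k * (1 + stdAddChar (-k)) =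
      1 - stdAddChar (-k) := by
  have hsum : 𝓕 (fun t : ZMod p => (paritySign t : ℂ)) k =
      ∑ i ∈ range p, (-stdAddChar (-k)) ^ i - 1 := by
    have h1 : (1 : ℂ) = ∑ t : ZMod p, if t = 0 then 1 else 0 := by simp
    have hpow : ∑ i ∈ range p, (-stdAddChar (-k)) ^ i =
        ∑ t : ZMod p, (-stdAddChar (-k)) ^ t.val := by
      rw [sum_eq_sum_range]
      refine sum_congr rfl fun i hi => ?_
      rw [val_cast_of_lt (mem_range.1 hi)]
    rw [dft_apply, hpow, h1, ← sum_sub_distrib]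
    refine sum_congr rfl fun t _ => ?_
    by_cases ht : t = 0
    · simp [ht, paritySign]
    · have hchar : stdAddChar (-(t * k)) = stdAddChar (-k) ^ t.val := by
        rw [← AddChar.map_nsmul_eq_pow, nsmul_eq_mul, natCast_zmod_val, mul_neg]
      rw [neg_pow, hchar]
      simp [ht, paritySign, mul_comm]
  have hone : stdAddChar (-k) ^ p = 1 := by
    rw [← AddChar.map_nsmul_eq_pow]
    simp
  have hgeom := geom_sum_mul (-stdAddChar (-k)) p
  rw [hp.neg_pow, hone] at hgeom
  rw [hsum]
  linear_combination -hgeom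

theorem dft_paritySign_zero {p : ℕ} [NeZero p] (hp : Odd p) :
    𝓕 (fun t : ZMod p => (paritySign t : ℂ)) 0 = 0 := by
  simpa using dft_paritySign_mul hp 0

theorem norm_dft_paritySign_le {p : ℕ} [NeZero p] (hp : Odd p) {k : ℕ} (hk : k < p) :
    ‖𝓕 (fun t : ZMod p => (paritySign t : ℂ)) k‖ ≤ p * |(p : ℝ) - 2 * k|⁻¹ := by
  have hne : 0 < |(p : ℝ) - 2 * k| := by
    rw [abs_pos, sub_ne_zero]
    norm_cast
    rintro rfl
    exact Nat.not_odd_iff_even.2 (even_two_mul k) hp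
  have hmul := congrArg norm (dft_paritySign_mul hp (k : ZMod p))
  rw [norm_mul] at hmul
  have htwo : ‖1 - stdAddChar (-(k : ZMod p))‖ ≤ 2 := by
    refine (norm_sub_le _ _).trans ?_
    rw [norm_one, AddChar.norm_apply]
    norm_num
  have hlow := two_mul_abs_le_mul_norm_one_add_stdAddChar k hk
  rw [← div_eq_mul_inv, le_div_iff₀ hne]
  have := mul_le_mul_of_nonneg_left hlow
    (norm_nonneg (𝓕 (fun t : ZMod p => (paritySign t : ℂ)) k))
  have hp0 : (0 : ℝ) ≤ p := p.cast_nonneg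
  nlinarith

theorem sum_range_inv_abs_sub_two_mul_le (n : ℕ) :
    ∑ k ∈ range (2 * n + 1), |((2 * n + 1 : ℕ) : ℝ) - 2 * k|⁻¹ ≤
      2 * (1 + Real.log (2 * n + 1 : ℕ)) := by
  have hlow : ∑ k ∈ range (n + 1), |((2 * n + 1 : ℕ) : ℝ) - 2 * k|⁻¹ =
      ∑ i ∈ range (n + 1), (2 * (i : ℝ) + 1)⁻¹ := by
    rw [← sum_range_reflect]
    refine sum_congr rfl fun i hi => ?_
    have hi' : i ≤ n := Nat.lt_succ_iff.1 (mem_range.1 hi)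
    rw [Nat.add_sub_cancel, Nat.cast_sub hi']
    push_cast
    rw [show 2 * (n : ℝ) + 1 - 2 * (n - i) = 2 * i + 1 by ring, abs_of_pos (by positivity)]
  have hhigh : ∑ i ∈ range n, |((2 * n + 1 : ℕ) : ℝ) - 2 * (n + 1 + i : ℕ)|⁻¹ ≤
      ∑ i ∈ range (n + 1), (2 * (i : ℝ) + 1)⁻¹ := by
    rw [sum_range_succ]
    refine le_add_of_le_of_nonneg (sum_le_sum fun i _ => ?_) (by positivity)
    push_cast
    rw [show 2 * (n : ℝ) + 1 - 2 * (n + 1 + i) = -(2 * i + 1) by ring, abs_neg,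
      abs_of_pos (by positivity)]
  have hharm : ∑ i ∈ range (n + 1), (2 * (i : ℝ) + 1)⁻¹ ≤ 1 + Real.log (2 * n + 1 : ℕ) := by
    have h1 : ∑ i ∈ range (n + 1), (2 * (i : ℝ) + 1)⁻¹ ≤ (harmonic (n + 1) : ℝ) := by
      rw [harmonic]
      push_cast
      refine sum_le_sum fun i _ => inv_anti₀ (by positivity) ?_
      linarith [(i.cast_nonneg : (0 : ℝ) ≤ i)]
    refine h1.trans ((harmonic_le_one_add_log _).trans ?_)
    gcongr
    omega
  rw [show 2 * n + 1 = (n + 1) + n by ring, sum_range_add]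
  rw [show (n + 1) + n = 2 * n + 1 by ring, hlow]
  linarith

theorem sum_norm_dft_paritySign_le {p : ℕ} [NeZero p] (hp : Odd p) (hp2 : 2 < p) :
    ∑ k, ‖𝓕 (fun t : ZMod p => (paritySign t : ℂ)) k‖ ≤ 4 * p * Real.log p := by
  have hlog : 1 ≤ Real.log p := by
    rw [Real.le_log_iff_exp_le (by positivity)]
    have : (3 : ℝ) ≤ p := mod_cast hp2
    linarith [Real.exp_one_lt_d9]
  have hsum : ∑ k ∈ range p, |(p : ℝ) - 2 * k|⁻¹ ≤ 2 * (1 + Real.log p) := by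
    obtain ⟨n, rfl⟩ := hp
    exact sum_range_inv_abs_sub_two_mul_le n
  calc ∑ k, ‖𝓕 (fun t : ZMod p => (paritySign t : ℂ)) k‖
      ≤ ∑ k ∈ range p, p * |(p : ℝ) - 2 * k|⁻¹ := by
        rw [sum_eq_sum_range]
        exact sum_le_sum fun k hk => norm_dft_paritySign_le hp (mem_range.1 hk)
    _ ≤ p * (2 * (1 + Real.log p)) := by
        rw [← mul_sum]
        gcongr
    _ ≤ 4 * p * Real.log p := by
        nlinarith [(p.cast_nonneg : (0 : ℝ) ≤ p)]

theorem sum_sq_sum_mul_paritySign_le {p : ℕ} [Fact p.Prime] (hp2 : 2 < p) (f : ZMod p → ℝ)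
    (hf : ∀ y, |f y| ≤ 1) :
    ∑ w, (∑ y, f y * paritySign (y * w)) ^ 2 ≤ 16 * p ^ 2 * Real.log p ^ 2 := by
  have hpp : p.Prime := Fact.out
  have hp : Odd p := hpp.odd_of_ne_two hp2.ne'
  have hp0 : (0 : ℝ) < p := mod_cast hpp.pos
  have hop := sum_norm_sq_sum_mul_comp_mul_le (fun t : ZMod p => (paritySign t : ℂ))
    (fun y => (f y : ℂ)) (dft_paritySign_zero hp)
  have hcast (w : ZMod p) : ‖∑ y, (f y : ℂ) * (paritySign (y * w) : ℂ)‖ ^ 2 =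
      (∑ y, f y * paritySign (y * w)) ^ 2 := by
    rw [← sq_abs (∑ y, f y * paritySign (y * w)), ← Real.norm_eq_abs, ← Complex.norm_real]
    push_cast
    rfl
  simp_rw [hcast] at hop
  have hl2 : ∑ y : ZMod p, ‖(f y : ℂ)‖ ^ 2 ≤ p := by
    refine (sum_le_card_nsmul univ _ 1 fun y _ => ?_).trans (by simp [ZMod.card])
    rw [Complex.norm_real]
    exact pow_le_one₀ (norm_nonneg _) (hf y)
  have hA := sum_norm_dft_paritySign_le hp hp2
  refine le_of_mul_le_mul_left (hop.trans ?_) hp0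
  calc _ ≤ (4 * p * Real.log p) ^ 2 * (p : ℝ) := by gcongr
    _ = p * (16 * p ^ 2 * Real.log p ^ 2) := by ring

/-- Under an isomorphism with `ZMod p`, discrete logarithms become quotients. -/
theorem natCast_eq_div_of_pow_eq {G : Type*} [Group G] {p : ℕ} [Fact p.Prime]
    (e : Multiplicative (ZMod p) ≃* G) {u y : ZMod p} (hu : u ≠ 0) {l : ℕ}
    (h : e (.ofAdd u) ^ l = e (.ofAdd y)) : (l : ZMod p) = y * u⁻¹ := by
  rw [← map_pow, e.injective.eq_iff, ← ofAdd_nsmul, Multiplicative.ofAdd.injective.eq_iff,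
    nsmul_eq_mul] at h
  rw [← h, mul_inv_cancel_right₀ hu]

theorem neg_one_pow_eq_paritySign {p l : ℕ} {t : ZMod p} (h : (l : ZMod p) = t) (hl : l < p)
    (ht : t ≠ 0) : (-1 : ℝ) ^ l = paritySign t := by
  rw [paritySign, if_neg ht, ← h, ZMod.val_cast_of_lt hl]

end


/-- There is an absolute constant `c₂ > 0` with the following property. For any finite
cyclic group `G` of prime order `p > 2` and any discrete-logarithm function
`L : G → G → ℕ` (so that `1 ≤ L a x ≤ p-1` and `a ^ L a x = x` for non-identity `a, x`),
the sum over ordered pairs `a ≠ b` of non-identity elements of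
`((1/(p-1)) · Σ_{x ≠ 1} (-1)^(L a x + L b x))²` is at most `c₂ · p · (ln p)²`. -/
theorem sum_sq_inner_parity_bits_le_general :
    ∃ c₂ : ℝ, 0 < c₂ ∧
      ∀ (G : Type) [Group G] [Fintype G] [DecidableEq G],
        IsCyclic G →
        ∀ p : ℕ, Nat.Prime p → 2 < p → Fintype.card G = p →
          ∀ L : G → G → ℕ,
            (∀ a x : G, a ≠ 1 → x ≠ 1 →
              1 ≤ L a x ∧ L a x ≤ p - 1 ∧ a ^ (L a x) = x) →
            ∑ q ∈ (Finset.univ : Finset (G × G)).filter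
                (fun q => q.1 ≠ 1 ∧ q.2 ≠ 1 ∧ q.1 ≠ q.2),
              ((1 / ((p : ℝ) - 1)) *
                  ∑ x ∈ (Finset.univ : Finset G).filter (fun x => x ≠ 1),
                    (-1 : ℝ) ^ (L q.1 x + L q.2 x)) ^ 2 ≤
              c₂ * p * (Real.log p) ^ 2 := by
  refine ⟨64, by norm_num, fun G _ _ _ hG p hpp hp2 hcard L hL => ?_⟩
  have : Fact p.Prime := ⟨hpp⟩
  have hp3 : (3 : ℝ) ≤ p := mod_cast hp2
  obtain ⟨e⟩ : Nonempty (Multiplicative (ZMod p) ≃* G) := by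
    obtain ⟨g, hg⟩ := hG.exists_generator
    exact ⟨zmodMulEquivOfGenerator hg (Nat.card_eq_fintype_card.trans hcard)⟩
  let E : ZMod p ≃ G := Multiplicative.ofAdd.trans e.toEquiv
  have hE (u : ZMod p) : E u ≠ 1 ↔ u ≠ 0 := by
    rw [not_iff_not]
    exact e.map_eq_one_iff.trans Iff.rfl
  have hsign {u y : ZMod p} (hu : u ≠ 0) (hy : y ≠ 0) :
      (-1 : ℝ) ^ L (E u) (E y) = paritySign (y * u⁻¹) := by
    obtain ⟨-, hlt, hpow⟩ := hL (E u) (E y) ((hE u).2 hu) ((hE y).2 hy)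
    exact neg_one_pow_eq_paritySign (natCast_eq_div_of_pow_eq e hu hpow)
      (by have := hpp.pos; omega) (mul_ne_zero hy (inv_ne_zero hu))
  have hinner {u v : ZMod p} (hu : u ≠ 0) (hv : v ≠ 0) :
      ∑ x ∈ (Finset.univ : Finset G).filter (fun x => x ≠ 1),
        (-1 : ℝ) ^ (L (E u) x + L (E v) x) =
      ∑ y, paritySign (y * u⁻¹) * paritySign (y * v⁻¹) := by
    rw [Finset.sum_filter, ← Equiv.sum_comp E]
    refine Finset.sum_congr rfl fun y _ => ?_
    by_cases hy : y = 0
    · rw [if_neg (by rw [hE]; exact not_not.2 hy)]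
      simp [hy, paritySign]
    · rw [if_pos ((hE y).2 hy), pow_add, hsign hu hy, hsign hv hy]
  have hterm (u v : ZMod p) :
      (if E u ≠ 1 ∧ E v ≠ 1 ∧ E u ≠ E v then
        ((1 / ((p : ℝ) - 1)) * ∑ x ∈ (Finset.univ : Finset G).filter (fun x => x ≠ 1),
          (-1 : ℝ) ^ (L (E u) x + L (E v) x)) ^ 2 else 0) ≤
      (1 / ((p : ℝ) - 1)) ^ 2 *
        (∑ y, paritySign (y * u⁻¹) * paritySign (y * v⁻¹)) ^ 2 := by
    split_ifs with h
    · rw [hinner ((hE u).1 h.1) ((hE v).1 h.2.1), mul_pow]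
    · positivity
  have hnorm : (1 / ((p : ℝ) - 1)) ^ 2 ≤ 4 / (p : ℝ) ^ 2 := by
    rw [div_pow, div_le_div_iff₀ (by nlinarith) (by positivity)]
    nlinarith
  rw [Finset.sum_filter, Fintype.sum_prod_type, ← Equiv.sum_comp E]
  simp_rw [← Equiv.sum_comp E (fun b => ite (E _ ≠ 1 ∧ b ≠ 1 ∧ E _ ≠ b) _ _)]
  calc _ ≤ ∑ u : ZMod p, ∑ v : ZMod p, (1 / ((p : ℝ) - 1)) ^ 2 *
          (∑ y, paritySign (y * u⁻¹) * paritySign (y * v⁻¹)) ^ 2 :=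
        Finset.sum_le_sum fun u _ => Finset.sum_le_sum fun v _ => hterm u v
    _ = (1 / ((p : ℝ) - 1)) ^ 2 * ∑ u : ZMod p, ∑ w : ZMod p,
          (∑ y, paritySign (y * u⁻¹) * paritySign (y * w)) ^ 2 := by
        simp_rw [← Finset.mul_sum]
        congr 1
        refine Finset.sum_congr rfl fun u _ => ?_
        exact Equiv.sum_comp (Equiv.inv (ZMod p)) fun w =>
          (∑ y, paritySign (y * u⁻¹) * paritySign (y * w)) ^ 2
    _ ≤ 4 / (p : ℝ) ^ 2 * ∑ _u : ZMod p, 16 * (p : ℝ) ^ 2 * Real.log p ^ 2 := by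
        gcongr with u
        exact sum_sq_sum_mul_paritySign_le hp2 _ fun y => abs_paritySign_le_one _
    _ = 64 * p * Real.log p ^ 2 := by
        rw [Finset.sum_const, Finset.card_univ, ZMod.card, nsmul_eq_mul]
        field_simp
        ring
end
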